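/- Let F ⊆ Sym²(ℝⁿ) be a convex cone subequation with edge E = F ∩ (−F) and polar cone F₊, and let W be the support of F, namely the intersection of all linear subspaces W' ⊆ ℝⁿ satisfying F₊ ⊆ Sym²(W'). Then the orthogonal complement of W equals the span of the unit vectors whose line projections lie in the edge: W^⊥ = span{e ∈ ℝⁿ : |e| = 1 and P_e ∈ E}. -/

import Mathlib

open Matrix Set Pointwise

noncomputable section

/-- `Sym²(ℝⁿ)`: the space of real symmetric `n × n` matrices,
realized as the self-adjoint elements of the matrix algebra. -/
abbrev SymMat (n : ℕ) : Type := ↥(selfAdjoint (Matrix (Fin n) (Fin n) ℝ))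

namespace SymMat

variable {n : ℕ}

/-- The trace inner product `⟨A, B⟩ = tr (A * B)` on `Sym²(ℝⁿ)`. -/
def tinner (A B : SymMat n) : ℝ :=
  ((A : Matrix (Fin n) (Fin n) ℝ) * (B : Matrix (Fin n) (Fin n) ℝ)).trace

/-- `𝒫`: the closed convex cone of positive semidefinite matrices. -/
def Psd (n : ℕ) : Set (SymMat n) :=
  {A | (A : Matrix (Fin n) (Fin n) ℝ).PosSemidef}

/-- The set of positive definite matrices (= `Int 𝒫`). -/
def Pd (n : ℕ) : Set (SymMat n) :=
  {A | (A : Matrix (Fin n) (Fin n) ℝ).PosDef}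

/-- A convex cone subequation: a closed convex cone `F ⊆ Sym²(ℝⁿ)` which is a nonempty
proper subset and satisfies the positivity condition `F + 𝒫 = F`. -/
structure IsSubequation (F : Set (SymMat n)) : Prop where
  nonempty : F.Nonempty
  proper : F ≠ Set.univ
  isClosed : IsClosed F
  convex : Convex ℝ F
  cone : ∀ t : ℝ, 0 ≤ t → ∀ A ∈ F, t • A ∈ F
  positivity : ∀ A ∈ F, ∀ P ∈ Psd n, A + P ∈ F

/-- The polar cone `F₊ = {B : ⟨A,B⟩ ≥ 0 ∀ A ∈ F}`. -/
def polarCone (F : Set (SymMat n)) : Set (SymMat n) :=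
  {B | ∀ A ∈ F, 0 ≤ tinner A B}

/-- The edge `E = F ∩ (−F)`. -/
def edge (F : Set (SymMat n)) : Set (SymMat n) := F ∩ (-F)

/-- Orthogonal complement (as a set) with respect to the trace inner product. -/
def orthSet (E : Set (SymMat n)) : Set (SymMat n) :=
  {B | ∀ A ∈ E, tinner A B = 0}

/-- `P_e = e eᵀ`, orthogonal projection onto the line spanned by `e`, as a symmetric matrix. -/
def lineProj (e : EuclideanSpace ℝ (Fin n)) : SymMat n :=
  ⟨Matrix.vecMulVec (WithLp.equiv 2 (Fin n → ℝ) e) (WithLp.equiv 2 (Fin n → ℝ) e), by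
    refine selfAdjoint.mem_iff.mpr ?_
    ext i j
    simp [Matrix.conjTranspose_apply, Matrix.vecMulVec_apply, mul_comm]⟩

/-- The matrix `P_W` of the orthogonal projection onto a subspace `W ⊆ ℝⁿ`. -/
def projMat (W : Submodule ℝ (EuclideanSpace ℝ (Fin n))) : Matrix (Fin n) (Fin n) ℝ :=
  Matrix.toEuclideanLin.symm ((W.subtypeL.comp (Submodule.orthogonalProjectionOnto W)).toLinearMap)

/-- `Sym²(W) = {A : A = P_W A P_W}`. -/
def symOn (W : Submodule ℝ (EuclideanSpace ℝ (Fin n))) : Set (SymMat n) :=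
  {A | (A : Matrix (Fin n) (Fin n) ℝ) = projMat W * A * projMat W}

/-- The restriction `F_W = {P_W A P_W : A ∈ F}` of `F` to `W` (inside `Sym²(W)`). -/
def restrictTo (F : Set (SymMat n)) (W : Submodule ℝ (EuclideanSpace ℝ (Fin n))) :
    Set (SymMat n) :=
  {B | ∃ A ∈ F, (B : Matrix (Fin n) (Fin n) ℝ) = projMat W * A * projMat W}

/-- `F` is extremely degenerate: the polar cone only involves the variables of some
proper subspace `W ⊊ ℝⁿ`. -/
def IsExtremelyDegenerate (F : Set (SymMat n)) : Prop :=
  ∃ W : Submodule ℝ (EuclideanSpace ℝ (Fin n)), W ≠ ⊤ ∧ polarCone F ⊆ symOn W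

/-- `F` is (dimensionally) complete. -/
def IsComplete (F : Set (SymMat n)) : Prop := ¬ IsExtremelyDegenerate F

/-- The interior of `F` relative to `S`. -/
def relInt (S F : Set (SymMat n)) : Set (SymMat n) :=
  {B | B ∈ S ∧ ∃ U : Set (SymMat n), IsOpen U ∧ B ∈ U ∧ U ∩ S ⊆ F}

/-- The support of `F`: the intersection of all subspaces `W'` with `F₊ ⊆ Sym²(W')`. -/
def support (F : Set (SymMat n)) : Submodule ℝ (EuclideanSpace ℝ (Fin n)) :=
  sInf {W | polarCone F ⊆ symOn W}

/-- The polar cone of `G` taken within `Sym²(W)`. -/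
def polarIn (G : Set (SymMat n)) (W : Submodule ℝ (EuclideanSpace ℝ (Fin n))) :
    Set (SymMat n) :=
  {B | B ∈ symOn W ∧ ∀ A ∈ G, 0 ≤ tinner A B}

end SymMat

namespace SymMat

/-- The operator of a symmetric matrix. -/
def opr {n : ℕ} (A : SymMat n) : EuclideanSpace ℝ (Fin n) →ₗ[ℝ] EuclideanSpace ℝ (Fin n) :=
  Matrix.toEuclideanLin (A : Matrix (Fin n) (Fin n) ℝ)

theorem opr_symm {n : ℕ} (A : SymMat n) : (opr A).IsSymmetric :=
  Matrix.isSymmetric_toEuclideanLin_iff.2 A.2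

theorem mem_symOn_iff {n : ℕ} (A : SymMat n) (W : Submodule ℝ (EuclideanSpace ℝ (Fin n))) :
    A ∈ symOn W ↔ ∀ x ∈ Wᗮ, opr A x = 0 := by
  have key : A ∈ symOn W ↔
      ∀ x, opr A x = W.starProjection (opr A (W.starProjection x)) := by
    have hp : ∀ x, Matrix.toEuclideanLin (projMat W) x = W.starProjection x := by
      intro x
      simp only [projMat, LinearEquiv.apply_symm_apply]
      rfl
    have hm : ∀ x, Matrix.toEuclideanLin
        (projMat W * (A : Matrix (Fin n) (Fin n) ℝ) * projMat W) x =
        W.starProjection (opr A (W.starProjection x)) := by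
      intro x
      rw [← hp, ← hp]
      simp [opr, Matrix.toEuclideanLin_apply, Matrix.mulVec_mulVec, Matrix.mul_assoc]
    constructor
    · intro h x
      rw [← hm]
      have h' : (A : Matrix (Fin n) (Fin n) ℝ) = projMat W * A * projMat W := h
      rw [← h']
      rfl
    · intro h
      show (A : Matrix (Fin n) (Fin n) ℝ) = projMat W * A * projMat W
      apply Matrix.toEuclideanLin.injective
      ext1 x
      rw [hm, ← h]
      rfl
  rw [key]
  constructor
  · intro h x hx
    rw [h, (Submodule.starProjection_apply_eq_zero_iff W).2 hx]
    simp
  · intro h x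
    have h1 : opr A x = opr A (W.starProjection x) := by
      have := h _ (Submodule.sub_starProjection_mem_orthogonal (K := W) x)
      rw [map_sub] at this
      exact sub_eq_zero.1 this
    rw [← h1]
    symm
    rw [Submodule.starProjection_eq_self_iff, ← Submodule.orthogonal_orthogonal W]
    rw [Submodule.mem_orthogonal]
    intro z hz
    rw [← opr_symm A z x, h z hz, inner_zero_left]

/-- The common kernel of the polar cone. -/
def comKer {n : ℕ} (F : Set (SymMat n)) : Submodule ℝ (EuclideanSpace ℝ (Fin n)) :=
  ⨅ B ∈ polarCone F, LinearMap.ker (opr B)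

theorem mem_comKer {n : ℕ} (F : Set (SymMat n)) (x : EuclideanSpace ℝ (Fin n)) :
    x ∈ comKer F ↔ ∀ B ∈ polarCone F, opr B x = 0 := by
  simp [comKer]

theorem support_orth {n : ℕ} (F : Set (SymMat n)) : (support F)ᗮ = comKer F := by
  have hs : ∀ W, polarCone F ⊆ symOn W ↔ Wᗮ ≤ comKer F := by
    intro W
    constructor
    · intro h x hx
      rw [mem_comKer]
      intro B hB
      exact (mem_symOn_iff B W).1 (h hB) x hx
    · intro h B hB
      rw [mem_symOn_iff]
      intro x hx
      exact (mem_comKer F x).1 (h hx) B hB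
  have : support F = (comKer F)ᗮ := by
    apply le_antisymm
    · apply sInf_le
      show polarCone F ⊆ _
      rw [hs, Submodule.orthogonal_orthogonal]
    · apply le_sInf
      intro W hW
      have := (hs W).1 hW
      have := Submodule.orthogonal_le this
      rwa [Submodule.orthogonal_orthogonal] at this
  rw [this, Submodule.orthogonal_orthogonal]

theorem zero_mem_of {n : ℕ} {F : Set (SymMat n)} (hF : IsSubequation F) : (0 : SymMat n) ∈ F := by
  obtain ⟨A, hA⟩ := hF.nonempty
  simpa using hF.cone 0 le_rfl A hA

theorem lineProj_psd {n : ℕ} (e : EuclideanSpace ℝ (Fin n)) : lineProj e ∈ Psd n := by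
  have := Matrix.posSemidef_vecMulVec_self_star (WithLp.equiv 2 (Fin n → ℝ) e)
  simpa [Psd, lineProj] using this

theorem lineProj_mem {n : ℕ} {F : Set (SymMat n)} (hF : IsSubequation F)
    (e : EuclideanSpace ℝ (Fin n)) : lineProj e ∈ F := by
  simpa using hF.positivity 0 (zero_mem_of hF) _ (lineProj_psd e)

theorem tinner_lineProj {n : ℕ} (e : EuclideanSpace ℝ (Fin n)) (B : SymMat n) :
    tinner (lineProj e) B = star e.ofLp ⬝ᵥ ((B : Matrix (Fin n) (Fin n) ℝ) *ᵥ e.ofLp) := by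
  simp only [tinner, lineProj, Matrix.trace_mul_comm _ (B : Matrix (Fin n) (Fin n) ℝ)]
  rw [Matrix.mul_vecMulVec, Matrix.trace_vecMulVec, dotProduct_comm]
  simp

theorem psd_of_polar {n : ℕ} {F : Set (SymMat n)} (hF : IsSubequation F) {B : SymMat n}
    (hB : B ∈ polarCone F) : (B : Matrix (Fin n) (Fin n) ℝ).PosSemidef := by
  refine Matrix.PosSemidef.of_dotProduct_mulVec_nonneg B.2 ?_
  intro x
  have := hB _ (lineProj_mem hF (WithLp.toLp 2 x))
  rwa [tinner_lineProj] at this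

theorem tinner_neg {n : ℕ} (A B : SymMat n) : tinner (-A) B = - tinner A B := by
  simp [tinner]

theorem bipolar {n : ℕ} {F : Set (SymMat n)} (hF : IsSubequation F) (A : SymMat n)
    (h : ∀ B ∈ polarCone F, 0 ≤ tinner A B) : A ∈ F := by
  by_contra hA
  let G : Set (Matrix (Fin n) (Fin n) ℝ) := Subtype.val '' F
  have hGc : IsClosed G := by
    have hc : IsClosed ((selfAdjoint (Matrix (Fin n) (Fin n) ℝ) : Set (Matrix (Fin n) (Fin n) ℝ))) := by
      have : (selfAdjoint (Matrix (Fin n) (Fin n) ℝ) : Set (Matrix (Fin n) (Fin n) ℝ))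
          = {M | Mᴴ = M} := by
        ext M; exact selfAdjoint.mem_iff
      rw [this]
      exact isClosed_eq (by fun_prop) continuous_id
    exact hc.isClosedEmbedding_subtypeVal.isClosedMap _ hF.isClosed
  have hGv : Convex ℝ G := by
    rintro _ ⟨x, hx, rfl⟩ _ ⟨y, hy, rfl⟩ a b ha hb hab
    exact ⟨a • x + b • y, hF.convex hx hy ha hb hab, by simp⟩
  have hAG : (A : Matrix (Fin n) (Fin n) ℝ) ∉ G := by
    rintro ⟨x, hx, hxA⟩
    exact hA (Subtype.ext hxA ▸ hx)
  haveI : LocallyConvexSpace ℝ (Matrix (Fin n) (Fin n) ℝ) :=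
    inferInstanceAs (LocallyConvexSpace ℝ (Fin n → Fin n → ℝ))
  obtain ⟨f, u, hfA, hfG⟩ := geometric_hahn_banach_point_closed hGv hGc hAG
  have hu : u < 0 := by
    have := hfG 0 ⟨0, zero_mem_of hF, rfl⟩
    simpa using this
  have hpos : ∀ x ∈ F, 0 ≤ f (x : Matrix (Fin n) (Fin n) ℝ) := by
    intro x hx
    by_contra! hneg
    have := hfG _ ⟨(u / f x) • x, hF.cone _ (div_nonneg_of_nonpos hu.le hneg.le) x hx, rfl⟩
    simp [hneg.ne] at this
  let B : SymMat n := ⟨Matrix.of fun i j =>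
      (f (Matrix.single i j 1) + f (Matrix.single j i 1)) / 2, by
    refine selfAdjoint.mem_iff.mpr ?_
    ext i j
    simp [Matrix.star_apply, add_comm]⟩
  have hB : ∀ x : SymMat n, tinner x B = f (x : Matrix (Fin n) (Fin n) ℝ) := by
    intro x
    have hx : ∀ i j, (x : Matrix (Fin n) (Fin n) ℝ) i j = (x : Matrix (Fin n) (Fin n) ℝ) j i := by
      intro i j
      have h1 : (x : Matrix (Fin n) (Fin n) ℝ)ᴴ = x := selfAdjoint.mem_iff.1 x.2
      have h2 := congrArg (fun M : Matrix (Fin n) (Fin n) ℝ => M i j) h1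
      simpa [Matrix.conjTranspose_apply] using h2.symm
    have e1 : f (x : Matrix (Fin n) (Fin n) ℝ) =
        ∑ i, ∑ j, (x : Matrix (Fin n) (Fin n) ℝ) i j * f (Matrix.single i j 1) := by
      conv_lhs => rw [Matrix.matrix_eq_sum_single (x : Matrix (Fin n) (Fin n) ℝ)]
      simp only [map_sum]
      refine Finset.sum_congr rfl fun i _ => Finset.sum_congr rfl fun j _ => ?_
      rw [← smul_eq_mul, ← map_smul]
      simp
    have e2 : f (x : Matrix (Fin n) (Fin n) ℝ) =
        ∑ i, ∑ j, (x : Matrix (Fin n) (Fin n) ℝ) i j * f (Matrix.single j i 1) := by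
      rw [e1, Finset.sum_comm]
      refine Finset.sum_congr rfl fun i _ => Finset.sum_congr rfl fun j _ => ?_
      rw [hx]
    have e3 : tinner x B = (f (x : Matrix (Fin n) (Fin n) ℝ) + f (x : Matrix (Fin n) (Fin n) ℝ)) / 2 := by
      nth_rewrite 1 [e1]
      rw [e2, ← Finset.sum_add_distrib, Finset.sum_div]
      simp only [tinner, Matrix.trace, Matrix.diag, Matrix.mul_apply]
      refine Finset.sum_congr rfl fun i _ => ?_
      rw [← Finset.sum_add_distrib, Finset.sum_div]
      refine Finset.sum_congr rfl fun j _ => ?_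
      simp only [B, Matrix.of_apply]
      ring
    rw [e3]; ring
  have := h B (fun x hx => by rw [hB]; exact hpos x hx)
  rw [hB] at this
  linarith

theorem lineProj_mem_edge {n : ℕ} {F : Set (SymMat n)} (hF : IsSubequation F)
    (e : EuclideanSpace ℝ (Fin n)) : lineProj e ∈ edge F ↔ e ∈ comKer F := by
  have hop : ∀ B : SymMat n, opr B e = 0 ↔ (B : Matrix (Fin n) (Fin n) ℝ) *ᵥ e.ofLp = 0 := by
    intro B
    simp [opr, Matrix.toEuclideanLin_apply]
  rw [mem_comKer]
  constructor
  · rintro ⟨-, h⟩ B hB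
    have h1 := hB _ h
    rw [tinner_neg, tinner_lineProj] at h1
    have hp := psd_of_polar hF hB
    rw [hop, ← hp.dotProduct_mulVec_zero_iff]
    have := hp.dotProduct_mulVec_nonneg e.ofLp
    linarith
  · intro h
    refine ⟨lineProj_mem hF e, ?_⟩
    apply bipolar hF
    intro B hB
    rw [tinner_neg, tinner_lineProj, (hop B).1 (h B hB)]
    simp

end SymMat

open SymMat in
theorem orth_support_eq_span {n : ℕ} (F : Set (SymMat n)) (hF : IsSubequation F) :
    (support F)ᗮ =
      Submodule.span ℝ {e : EuclideanSpace ℝ (Fin n) | ‖e‖ = 1 ∧ lineProj e ∈ edge F} := by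
  rw [support_orth]
  simp only [lineProj_mem_edge hF]
  apply le_antisymm
  · intro x hx
    by_cases h0 : x = 0
    · rw [h0]; exact Submodule.zero_mem _
    · have hn : ‖x‖ ≠ 0 := norm_ne_zero_iff.2 h0
      have : x = ‖x‖ • (‖x‖⁻¹ • x) := by rw [smul_smul, mul_inv_cancel₀ hn, one_smul]
      rw [this]
      refine Submodule.smul_mem _ _ (Submodule.subset_span ⟨?_, Submodule.smul_mem _ _ hx⟩)
      rw [norm_smul, norm_inv, norm_norm, inv_mul_cancel₀ hn]
  · rw [Submodule.span_le]
    exact fun x hx => hx.2
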